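/- Let U be a free (non-principal) ultrafilter on ℕ, identified with the subset χ(U) = {1_A : A ∈ U} of Ω = {0,1}^ℕ, and let λ be the infinite product on Ω of the fair Bernoulli measure (½)(δ₀ + δ₁) on {0,1}. Then the outer measure of χ(U) equals 1: λ*(χ(U)) = 1. -/

import Mathlib

open Filter MeasureTheory

/-- `χ(U) = {1_A : A ∈ U} ⊆ Ω = {0,1}^ℕ`, realized as `ℕ → Bool`. -/
def chiF (F : Filter ℕ) : Set (ℕ → Bool) := {ω | {n | ω n = true} ∈ F}

/-- The cylinder prescribed by `f` on `s`. -/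
def cylF (s : Finset ℕ) (f : ℕ → Bool) : Set (ℕ → Bool) := {ω | ∀ n ∈ s, ω n = f n}

lemma measurable_cylF (s : Finset ℕ) (f : ℕ → Bool) : MeasurableSet (cylF s f) := by
  have : cylF s f = ⋂ n ∈ s, (fun ω : ℕ → Bool => ω n) ⁻¹' {f n} := by
    ext ω; simp [cylF]
  rw [this]
  exact Finset.measurableSet_biInter _ fun n _ => measurable_pi_apply n (measurableSet_singleton _)

lemma ext_cylF (μ ν : Measure (ℕ → Bool)) [IsFiniteMeasure μ]
    (h : ∀ s f, μ (cylF s f) = ν (cylF s f)) : μ = ν := by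
  refine ext_of_generate_finite {A | ∃ s f, A = cylF s f} ?_ ?_ ?_ ?_
  · apply le_antisymm
    · refine iSup_le fun n => ?_
      rintro _ ⟨t, -, rfl⟩
      have hs : ((fun ω : ℕ → Bool => ω n) ⁻¹' t) = ⋃ b ∈ t, cylF {n} (fun _ => b) := by
        ext ω; simp [cylF]
      change MeasurableSet[MeasurableSpace.generateFrom _] ((fun ω : ℕ → Bool => ω n) ⁻¹' t)
      rw [hs]
      exact MeasurableSet.biUnion (Set.to_countable t)
        fun b _ => MeasurableSpace.measurableSet_generateFrom ⟨_, _, rfl⟩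
    · refine MeasurableSpace.generateFrom_le ?_
      rintro _ ⟨s, f, rfl⟩
      exact measurable_cylF s f
  · rintro _ ⟨s, f, rfl⟩ _ ⟨t, g, rfl⟩ ⟨ω, h1, h2⟩
    refine ⟨s ∪ t, ω, ?_⟩
    ext η
    simp only [cylF, Set.mem_inter_iff, Set.mem_ofPred_eq, Finset.mem_union] at *
    constructor
    · rintro ⟨a, b⟩ n (hn | hn)
      · rw [a n hn, h1 n hn]
      · rw [b n hn, h2 n hn]
    · intro a
      exact ⟨fun n hn => by rw [a n (Or.inl hn), h1 n hn],
        fun n hn => by rw [a n (Or.inr hn), h2 n hn]⟩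
  · rintro _ ⟨s, f, rfl⟩
    exact h s f
  · simpa [cylF] using h ∅ (fun _ => true)

/-- Flipping the coordinates where `g` is true. -/
def flipE (g : ℕ → Bool) : (ℕ → Bool) ≃ᵐ (ℕ → Bool) where
  toFun ω n := xor (ω n) (g n)
  invFun ω n := xor (ω n) (g n)
  left_inv ω := by ext n; simp
  right_inv ω := by ext n; simp
  measurable_toFun := measurable_pi_lambda _ fun n =>
    (measurable_of_countable (fun b : Bool => xor b (g n))).comp (measurable_pi_apply n)
  measurable_invFun := measurable_pi_lambda _ fun n =>
    (measurable_of_countable (fun b : Bool => xor b (g n))).comp (measurable_pi_apply n)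

lemma flipE_apply (g ω : ℕ → Bool) (n : ℕ) : flipE g ω n = xor (ω n) (g n) := rfl

lemma flip_preserves (lam : Measure (ℕ → Bool)) [IsProbabilityMeasure lam]
    (hlam : ∀ (s : Finset ℕ) (f : ℕ → Bool),
      lam {ω | ∀ n ∈ s, ω n = f n} = (1 / 2 : ENNReal) ^ s.card) (g : ℕ → Bool)
    (A : Set (ℕ → Bool)) : lam (flipE g ⁻¹' A) = lam A := by
  rw [← MeasurableEquiv.map_apply]
  congr 1
  symm
  apply ext_cylF
  intro s f
  rw [MeasurableEquiv.map_apply]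
  have : flipE g ⁻¹' (cylF s f) = cylF s (fun n => xor (f n) (g n)) := by
    ext ω
    simp only [cylF, Set.mem_preimage, Set.mem_ofPred_eq, flipE_apply]
    refine forall₂_congr fun n _ => ?_
    cases ω n <;> cases f n <;> cases g n <;> simp
  rw [this]
  exact (hlam s f).trans (hlam s _).symm

theorem free_ultrafilter_outer_measure_one (U : Ultrafilter ℕ)
    (hU : ∀ A : Set ℕ, A.Finite → A ∉ U)
    (lam : Measure (ℕ → Bool)) [IsProbabilityMeasure lam]
    (hlam : ∀ (s : Finset ℕ) (f : ℕ → Bool),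
      lam {ω | ∀ n ∈ s, ω n = f n} = (1 / 2 : ENNReal) ^ s.card) :
    lam (chiF (U : Filter ℕ)) = 1 := by
  set S := chiF (U : Filter ℕ) with hS
  have hpres := flip_preserves lam hlam
  -- positivity, via the global flip
  have hcompl : flipE (fun _ => true) ⁻¹' S = Sᶜ := by
    ext ω
    have : {n | flipE (fun _ => true) ω n = true} = {n | ω n = true}ᶜ := by
      ext n; simp [flipE_apply]
    simp only [hS, chiF, Set.mem_preimage, Set.mem_ofPred_eq, this, Set.mem_compl_iff]
    exact Ultrafilter.compl_mem_iff_notMem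
  have hpos : lam S ≠ 0 := by
    intro h0
    have h1 : lam Sᶜ = 0 := by rw [← hcompl, hpres, h0]
    have h2 : lam (S ∪ Sᶜ) = 0 := measure_union_null h0 h1
    simp at h2
  -- invariance under flipping one coordinate
  have hinv : ∀ m : ℕ, flipE (fun n => decide (n = m)) ⁻¹' S = S := by
    intro m
    ext ω
    simp only [hS, chiF, Set.mem_preimage, Set.mem_ofPred_eq]
    have hm : ({m}ᶜ : Set ℕ) ∈ (U : Filter ℕ) :=
      Ultrafilter.compl_mem_iff_notMem.2 (hU _ (Set.finite_singleton m))
    apply Filter.congr_sets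
    filter_upwards [hm] with n hn
    have hn' : n ≠ m := hn
    simp [flipE_apply, hn']
  have hcyl : ∀ (s : Finset ℕ) (f : ℕ → Bool),
      lam (cylF s f ∩ S) = lam S * (1 / 2 : ENNReal) ^ s.card := by
    intro s f
    induction s using Finset.induction_on with
    | empty => simp [cylF]
    | insert m s hm ih =>
      have hsplit := measure_inter_add_diff (μ := lam) (cylF s f ∩ S) (measurable_cylF {m} f)
      have e1 : cylF s f ∩ S ∩ cylF {m} f = cylF (insert m s) f ∩ S := by
        ext ω
        simp [cylF]
        tauto
      have e2 : (cylF s f ∩ S) \ cylF {m} f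
          = flipE (fun n => decide (n = m)) ⁻¹' (cylF (insert m s) f ∩ S) := by
        rw [Set.preimage_inter, hinv]
        ext ω
        have hk : (∀ n ∈ s, xor (ω n) (decide (n = m)) = f n) ↔ ∀ n ∈ s, ω n = f n := by
          refine forall₂_congr fun n hn => ?_
          have : n ≠ m := fun h => hm (h ▸ hn)
          simp [this]
        have hk2 : (!ω m) = f m ↔ ¬ ω m = f m := by
          cases ω m <;> cases f m <;> simp
        simp only [cylF, Set.mem_diff, Set.mem_inter_iff, Set.mem_ofPred_eq, Set.mem_preimage,
          Finset.forall_mem_insert, flipE_apply, hk, Finset.mem_singleton, forall_eq,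
          decide_true, Bool.xor_true, hk2]
        tauto
      rw [e2, hpres, e1, ih, ← two_mul] at hsplit
      rw [Finset.card_insert_of_notMem hm, pow_succ, ← mul_assoc, ← hsplit, mul_comm, ← mul_assoc]
      rw [one_div, ENNReal.inv_mul_cancel (by simp) (by simp), one_mul]
  have hν : lam.restrict S = lam S • lam := by
    apply ext_cylF
    intro s f
    rw [Measure.restrict_apply (measurable_cylF s f), hcyl, Measure.smul_apply, smul_eq_mul]
    congr 1
    exact (hlam s f).symm
  have hB := measurableSet_toMeasurable lam S
  have h0 : lam.restrict S (toMeasurable lam S)ᶜ = 0 := by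
    rw [Measure.restrict_apply hB.compl]
    have : (toMeasurable lam S)ᶜ ∩ S = ∅ := by
      ext ω
      simp only [Set.mem_inter_iff, Set.mem_compl_iff, Set.mem_empty_iff_false, iff_false]
      exact fun h => h.1 (subset_toMeasurable lam S h.2)
    rw [this, measure_empty]
  rw [hν, Measure.smul_apply, smul_eq_mul, mul_eq_zero, or_iff_right hpos,
    prob_compl_eq_zero_iff hB, measure_toMeasurable] at h0
  exact h0
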